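/- Let G be a 2-connected chordal graph. Then G is matching-decyclable if and only if G is a diamond or a triangle. -/

import Mathlib

open SimpleGraph

/-- `M` is a matching contained in the edge set of `G`. -/
def IsMatchingIn {V : Type*} (G : SimpleGraph V) (M : Set (Sym2 V)) : Prop :=
  M ⊆ G.edgeSet ∧ ∀ e ∈ M, ∀ f ∈ M, e ≠ f → ∀ v : V, v ∈ e → v ∉ f

/-- `G` is matching-decyclable: some matching `M ⊆ E(G)` has `G - M` acyclic. -/
def MDecyclable {V : Type*} (G : SimpleGraph V) : Prop :=
  ∃ M : Set (Sym2 V), IsMatchingIn G M ∧ (G.deleteEdges M).IsAcyclic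

/-- `G` is sparse: every nonempty subgraph `H` satisfies `|E(H)| ≤ ⌊3|V(H)|/2⌋ - 1`. -/
def Sparse {V : Type*} (G : SimpleGraph V) : Prop :=
  ∀ H : G.Subgraph, H.verts.Nonempty →
    Nat.card H.edgeSet ≤ 3 * Nat.card H.verts / 2 - 1

/-- A graph is 2-connected: connected, at least 3 vertices, and no cut vertex. -/
def TwoConnected {V : Type*} (G : SimpleGraph V) : Prop :=
  G.Connected ∧ 3 ≤ Nat.card V ∧
    ∀ v : V, (((⊤ : G.Subgraph).deleteVerts {v}).coe).Connected

/-- `G` is fairly cubic: exactly two vertices of degree 2, the rest of degree 3. -/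
def FairlyCubic {V : Type*} [Fintype V] (G : SimpleGraph V) [DecidableRel G.Adj] : Prop :=
  Nat.card {v : V // G.degree v = 2} = 2 ∧ ∀ v : V, G.degree v = 2 ∨ G.degree v = 3

def diamondGraph : SimpleGraph (Fin 4) :=
  SimpleGraph.fromEdgeSet {s(0,1), s(0,2), s(0,3), s(1,2), s(2,3)}

def triangleGraph : SimpleGraph (Fin 3) := ⊤

def gemGraph : SimpleGraph (Fin 5) :=
  SimpleGraph.fromEdgeSet {s(0,1), s(1,2), s(2,3), s(0,4), s(1,4), s(2,4), s(3,4)}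

def houseGraph : SimpleGraph (Fin 5) :=
  SimpleGraph.fromEdgeSet {s(0,1), s(1,2), s(2,3), s(0,3), s(0,4), s(1,4)}

def dominoGraph : SimpleGraph (Fin 6) :=
  SimpleGraph.fromEdgeSet {s(0,1), s(1,2), s(2,3), s(0,3), s(1,4), s(4,5), s(2,5)}

/-- `K_{3,3}` minus one edge. -/
def K33minus : SimpleGraph (Fin 3 ⊕ Fin 3) :=
  SimpleGraph.fromEdgeSet
    {e ∈ (completeBipartiteGraph (Fin 3) (Fin 3)).edgeSet | e ≠ s(Sum.inl 0, Sum.inr 0)}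

/-- `G` contains `H` as a (not necessarily induced) subgraph. -/
def ContainsSub {V W : Type*} (G : SimpleGraph V) (H : SimpleGraph W) : Prop :=
  ∃ B : G.Subgraph, Nonempty (B.coe ≃g H)

/-- Chordal: no induced cycle of length at least 4. -/
def Chordal {V : Type*} (G : SimpleGraph V) : Prop :=
  ∀ n : ℕ, 4 ≤ n → IsEmpty (SimpleGraph.cycleGraph n ↪g G)

/-- Distance-hereditary: no induced house, hole, domino, or gem. -/
def DistHereditary {V : Type*} (G : SimpleGraph V) : Prop :=
  IsEmpty (houseGraph ↪g G) ∧ IsEmpty (dominoGraph ↪g G) ∧ IsEmpty (gemGraph ↪g G) ∧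
    ∀ n : ℕ, 5 ≤ n → IsEmpty (SimpleGraph.cycleGraph n ↪g G)

/-- `v` is a cut vertex of `G`. -/
def IsCutVertex {V : Type*} (G : SimpleGraph V) (v : V) : Prop :=
  G.Connected ∧ ¬ (((⊤ : G.Subgraph).deleteVerts {v}).coe).Connected

/-- A block of `G`: either (the subgraph spanned by) a bridge, or a maximal
2-connected subgraph. -/
def IsBlock {V : Type*} (G : SimpleGraph V) (B : G.Subgraph) : Prop :=
  (∃ u w : V, G.IsBridge s(u, w) ∧ B.verts = {u, w} ∧ B.edgeSet = {s(u, w)}) ∨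
  (TwoConnected B.coe ∧ ∀ B' : G.Subgraph, B ≤ B' → TwoConnected B'.coe → B' = B)

/-- A leaf block: a block containing exactly one cut vertex of `G`. -/
def IsLeafBlock {V : Type*} (G : SimpleGraph V) (B : G.Subgraph) : Prop :=
  IsBlock G B ∧ ∃! v : V, v ∈ B.verts ∧ IsCutVertex G v

/-- A chain: a connected graph with exactly two leaf blocks, whose leaf blocks are
diamonds and whose non-leaf blocks are triangles. -/
def IsChainGraph {V : Type*} (G : SimpleGraph V) : Prop :=
  G.Connected ∧
  Nat.card {B : G.Subgraph // IsLeafBlock G B} = 2 ∧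
  (∀ B : G.Subgraph, IsLeafBlock G B → Nonempty (B.coe ≃g diamondGraph)) ∧
  (∀ B : G.Subgraph, IsBlock G B → ¬ IsLeafBlock G B → Nonempty (B.coe ≃g triangleGraph))

namespace SimpleGraph

variable {V : Type*} {G : SimpleGraph V}

/-- The edges of `G` with both ends in `S`, as a graph on all the vertices. -/
def within (G : SimpleGraph V) (S : Set V) : SimpleGraph V where
  Adj u v := G.Adj u v ∧ u ∈ S ∧ v ∈ S
  symm := ⟨fun _ _ h => ⟨h.1.symm, h.2.2, h.2.1⟩⟩
  loopless := ⟨fun _ h => h.1.ne rfl⟩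

/-- Along a geodesic, the index gap of two vertices is at most the length of any walk
joining them. -/
lemma Walk.le_add_length_of_length_eq_dist {x y : V} {p : G.Walk x y}
    (hp : p.length = G.dist x y) {i j : ℕ} (hi : i ≤ p.length) (hj : j ≤ p.length)
    (q : G.Walk (p.getVert i) (p.getVert j)) : j ≤ i + q.length := by
  have h := dist_le (((p.take i).append q).append (p.drop j))
  simp only [Walk.length_append, Walk.take_length, Walk.drop_length] at h
  omega

/-- Vertices `f 0, …, f (n - 1)` adjacent exactly when cyclically consecutive induce a cycle. -/
lemma nonempty_cycleGraph_embedding {n : ℕ} (f : ℕ → V)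
    (hne : ∀ i j, i < j → j < n → f i ≠ f j)
    (hadj : ∀ i j, i < j → j < n → (G.Adj (f i) (f j) ↔ j = i + 1 ∨ (i = 0 ∧ j + 1 = n))) :
    Nonempty (cycleGraph n ↪g G) := by
  have hlt : ∀ a b : Fin n, a < b →
      ((cycleGraph n).Adj a b ↔ b.val = a.val + 1 ∨ (a.val = 0 ∧ b.val + 1 = n)) := by
    intro a b hab
    have hab' : a.val < b.val := hab
    have hb := b.isLt
    rw [cycleGraph_adj', Fin.sub_val_of_le hab.le, Fin.val_sub, Nat.mod_eq_of_lt (by omega)]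
    omega
  refine ⟨⟨⟨fun a => f a, fun a b hab => ?_⟩, fun {a b} => ?_⟩⟩
  · rcases lt_trichotomy a b with h | h | h
    · exact absurd hab (hne _ _ h b.isLt)
    · exact h
    · exact absurd hab.symm (hne _ _ h a.isLt)
  · change G.Adj (f a) (f b) ↔ _
    rcases lt_trichotomy a b with h | h | h
    · rw [hlt a b h, hadj _ _ h b.isLt]
    · simp [h]
    · rw [G.adj_comm, (cycleGraph n).adj_comm, hlt b a h, hadj _ _ h a.isLt]

lemma mem_of_walk_within {S : Set V} {x y : V} (hx : x ∈ S) (p : (G.within S).Walk x y) :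
    y ∈ S := by
  induction p with
  | nil => exact hx
  | cons h p ih => exact ih h.2.2

/-- Two internally disjoint geodesics, one inside `S` and one leaving `S`, form an induced cycle
when the latter joins a closest pair of vertices of `S`. -/
lemma nonempty_cycleGraph_embedding_of_geodesics {S : Set V} {x y : V} (hx : x ∈ S) (hxy : x ≠ y)
    (hS : (G.within S).Reachable x y) (hH : (G \ G.within S).Reachable y x)
    (hd : 3 ≤ (G \ G.within S).dist y x)
    (hmin : ∀ a ∈ S, ∀ b ∈ S, a ≠ b → (G \ G.within S).Reachable a b →
      (G \ G.within S).dist y x ≤ (G \ G.within S).dist a b) :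
    ∃ n, 4 ≤ n ∧ Nonempty (cycleGraph n ↪g G) := by
  obtain ⟨p, hp⟩ := hS.exists_walk_length_eq_dist
  obtain ⟨q, hq⟩ := hH.exists_walk_length_eq_dist
  have hy : y ∈ S := mem_of_walk_within hx p
  have hl : 1 ≤ p.length := by
    rw [hp]; exact hS.pos_dist_of_ne hxy
  have hpS : ∀ i, p.getVert i ∈ S := fun i => mem_of_walk_within hx (p.take i)
  have hend : ∀ i ≤ q.length, ∀ s ∈ S, (w : (G \ G.within S).Walk (q.getVert i) s) →
      (s ≠ y → q.length ≤ i + w.length) ∧ (s ≠ x → i ≤ w.length) := by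
    intro i hi s hs w
    constructor
    · intro h
      have h1 := hmin y hy s hs h.symm ⟨(q.take i).append w⟩
      have h2 := dist_le ((q.take i).append w)
      simp only [Walk.length_append, Walk.take_length] at h2
      omega
    · intro h
      have h1 := hmin s hs x hx h ⟨w.reverse.append (q.drop i)⟩
      have h2 := dist_le (w.reverse.append (q.drop i))
      simp only [Walk.length_append, Walk.drop_length, Walk.length_reverse] at h2
      omega
  have hqS : ∀ i, 0 < i → i < q.length → q.getVert i ∉ S := by
    intro i h0 hi hs
    have h := hend i hi.le _ hs .nil
    simp only [Walk.length_nil] at h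
    by_cases h' : q.getVert i = x
    · have := h.1 (by rw [h']; exact hxy)
      omega
    · have := h.2 h'
      omega
  have hpadj : ∀ i j, i < j → j ≤ p.length →
      p.getVert i ≠ p.getVert j ∧ (G.Adj (p.getVert i) (p.getVert j) ↔ j = i + 1) := by
    intro i j hij hj
    refine ⟨fun h => ?_, fun h => ?_, ?_⟩
    · have := Walk.le_add_length_of_length_eq_dist hp (by omega) hj (Walk.nil.copy rfl h)
      simp only [Walk.length_copy, Walk.length_nil] at this
      omega
    · have hK : (G.within S).Adj (p.getVert i) (p.getVert j) := ⟨h, hpS _, hpS _⟩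
      have := Walk.le_add_length_of_length_eq_dist hp (by omega) hj hK.toWalk
      simp only [Adj.toWalk, Walk.length_cons, Walk.length_nil] at this
      omega
    · rintro rfl
      exact (p.adj_getVert_succ (by omega)).1
  have hqadj : ∀ i j, i < j → j ≤ q.length → q.getVert i ≠ q.getVert j ∧
      ((G \ G.within S).Adj (q.getVert i) (q.getVert j) ↔ j = i + 1) := by
    intro i j hij hj
    refine ⟨fun h => ?_, fun h => ?_, ?_⟩
    · have := Walk.le_add_length_of_length_eq_dist hq (by omega) hj (Walk.nil.copy rfl h)
      simp only [Walk.length_copy, Walk.length_nil] at this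
      omega
    · have := Walk.le_add_length_of_length_eq_dist hq (by omega) hj h.toWalk
      simp only [Adj.toWalk, Walk.length_cons, Walk.length_nil] at this
      omega
    · rintro rfl
      exact q.adj_getVert_succ (by omega)
  have hout : ∀ {u v}, u ∉ S → (G.Adj u v ↔ (G \ G.within S).Adj u v) := by
    intro u v hu
    simp [within, hu]
  have hcross : ∀ i, 0 < i → i < q.length → ∀ s ∈ S, G.Adj (q.getVert i) s →
      (s = y ∧ i = 1) ∨ (s = x ∧ i + 1 = q.length) := by
    intro i h0 hi s hs h
    have h := hend i hi.le s hs ((hout (hqS i h0 hi)).1 h).toWalk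
    simp only [Adj.toWalk, Walk.length_cons, Walk.length_nil] at h
    by_cases hsy : s = y
    · have := h.2 (hsy ▸ hxy.symm)
      left; exact ⟨hsy, by omega⟩
    · have h1 := h.1 hsy
      by_cases hsx : s = x
      · right; exact ⟨hsx, by omega⟩
      · have := h.2 hsx
        omega
  have hpx : ∀ i ≤ p.length, p.getVert i = x → i = 0 := by
    intro i hi h
    by_contra h0
    exact (hpadj 0 i (by omega) hi).1 (by simp [h])
  have hpy : ∀ i ≤ p.length, p.getVert i = y → i = p.length := by
    intro i hi h
    by_contra h0
    exact (hpadj i p.length (by omega) le_rfl).1 (by simp [h])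
  have hq1 : G.Adj (q.getVert 1) y := by
    simpa using (q.adj_getVert_succ (i := 0) (by omega)).1.symm
  have hqm : G.Adj (q.getVert (q.length - 1)) x := by
    have h := (q.adj_getVert_succ (i := q.length - 1) (by omega)).1
    rwa [Nat.sub_add_cancel (by omega), Walk.getVert_length] at h
  refine ⟨p.length + q.length, by omega, nonempty_cycleGraph_embedding
    (fun i => if i ≤ p.length then p.getVert i else q.getVert (i - p.length)) ?_ ?_⟩
  · intro i j hij hj
    by_cases h1 : j ≤ p.length
    · simpa [h1, hij.le.trans h1] using (hpadj i j hij h1).1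
    · by_cases h2 : i ≤ p.length
      · simp only [h1, h2, if_true, if_false]
        intro h
        exact hqS (j - p.length) (by omega) (by omega) (h ▸ hpS i)
      · simpa [h1, h2] using (hqadj (i - p.length) (j - p.length) (by omega) (by omega)).1
  · intro i j hij hj
    by_cases h1 : j ≤ p.length
    · simp only [h1, hij.le.trans h1, if_true]
      rw [(hpadj i j hij h1).2]
      omega
    · by_cases h2 : i ≤ p.length
      · simp only [h1, h2, if_true, if_false]
        constructor
        · intro h
          rcases hcross (j - p.length) (by omega) (by omega) _ (hpS i) h.symm with h | h
          · have := hpy i h2 h.1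
            omega
          · have := hpx i h2 h.1
            omega
        · rintro (h | ⟨h, h'⟩)
          · obtain rfl : i = p.length := by omega
            have : j - p.length = 1 := by omega
            rw [this]
            simpa using hq1.symm
          · have : j - p.length = q.length - 1 := by omega
            rw [this, h]
            simpa using hqm.symm
      · simp only [h1, h2, if_false]
        rw [hout (hqS _ (by omega) (by omega)),
          (hqadj (i - p.length) (j - p.length) (by omega) (by omega)).2]
        omega

end SimpleGraph

namespace TwoConnected

variable {V : Type*} {G : SimpleGraph V}

lemma reachable_within_compl (h : TwoConnected G) {v u w : V} (hu : u ≠ v) (hw : w ≠ v) :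
    (G.within {v}ᶜ).Reachable u w := by
  let f : ((⊤ : G.Subgraph).deleteVerts {v}).coe →g G.within {v}ᶜ :=
    { toFun := fun a => a
      map_rel' := fun {a b} hab => by
        rw [Subgraph.coe_adj, Subgraph.deleteVerts_adj] at hab
        exact ⟨hab.2.2.2.2, hab.2.1, hab.2.2.2.1⟩ }
  exact ((h.2.2 v).preconnected ⟨u, by simpa using hu⟩ ⟨w, by simpa using hw⟩).map f

/-- Some two vertices of `S` are joined by a path that uses no edge inside `S`. -/
lemma exists_ear (h : TwoConnected G) {S : Set V} (hS : S.Nontrivial) (hne : S ≠ Set.univ) :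
    ∃ x ∈ S, ∃ y ∈ S, x ≠ y ∧ (G \ G.within S).Reachable y x := by
  obtain ⟨x, p, hx, hp, hxp⟩ : ∃ x p, x ∈ S ∧ p ∉ S ∧ G.Adj x p := by
    by_contra! hcl
    obtain ⟨a, ha⟩ := hS.nonempty
    refine hne (Set.eq_univ_of_forall fun b => ?_)
    obtain ⟨w⟩ := h.1.preconnected a b
    induction w with
    | nil => exact ha
    | cons hadj w ih => exact ih (by_contra fun hc => hcl _ _ ha hc hadj)
  obtain ⟨y, hy, hyx⟩ := hS.exists_ne x
  obtain ⟨w⟩ := h.reachable_within_compl (v := x) (u := p) (w := y) (by rintro rfl; exact hp hx) hyx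
  have key : ∀ {u v}, (G.within {x}ᶜ).Walk u v → v ∈ S → v ≠ x →
      ∃ s ∈ S, s ≠ x ∧ (G \ G.within S).Reachable s u := by
    intro u v w hv hvx
    induction w with
    | nil => exact ⟨_, hv, hvx, .rfl⟩
    | @cons a b c hab w ih =>
      by_cases ha : a ∈ S
      · exact ⟨a, ha, hab.2.1, .rfl⟩
      · obtain ⟨s, hs, hsx, hr⟩ := ih hv hvx
        refine ⟨s, hs, hsx, hr.trans (Adj.reachable ?_)⟩
        exact ⟨hab.1.symm, fun hc => ha hc.2.2⟩
  obtain ⟨s, hs, hsx, hr⟩ := key w hy hyx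
  refine ⟨x, hx, s, hs, hsx.symm, hr.trans (Adj.reachable ?_)⟩
  exact ⟨hxp.symm, fun hc => hp hc.2.1⟩

/-- In a 2-connected chordal graph, a connected proper vertex set with at least two elements has
an outside vertex with two neighbours in it. -/
lemma exists_notMem_adj_adj (h : TwoConnected G) (hch : Chordal G) {S : Set V}
    (hS : S.Nontrivial) (hne : S ≠ Set.univ)
    (hconn : ∀ x ∈ S, ∀ y ∈ S, (G.within S).Reachable x y) :
    ∃ w ∉ S, ∃ x ∈ S, ∃ y ∈ S, x ≠ y ∧ G.Adj w x ∧ G.Adj w y := by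
  classical
  have hex : ∃ d, ∃ x ∈ S, ∃ y ∈ S, x ≠ y ∧ (G \ G.within S).Reachable y x ∧
      (G \ G.within S).dist y x = d := by
    obtain ⟨x, hx, y, hy, hxy, hr⟩ := h.exists_ear hS hne
    exact ⟨_, x, hx, y, hy, hxy, hr, rfl⟩
  obtain ⟨x, hx, y, hy, hxy, hr, hd⟩ := Nat.find_spec hex
  have hmin : ∀ a ∈ S, ∀ b ∈ S, a ≠ b → (G \ G.within S).Reachable a b →
      (G \ G.within S).dist y x ≤ (G \ G.within S).dist a b := by
    intro a ha b hb hab hrab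
    rw [hd]
    exact Nat.find_min' hex ⟨b, hb, a, ha, hab.symm, hrab, rfl⟩
  by_cases h3 : 3 ≤ (G \ G.within S).dist y x
  · obtain ⟨n, hn, ⟨e⟩⟩ := nonempty_cycleGraph_embedding_of_geodesics hx hxy (hconn x hx y hy)
      hr h3 hmin
    exact ((hch n hn).false e).elim
  · obtain ⟨q, hq⟩ := hr.exists_walk_length_eq_dist
    cases q with
    | nil => exact absurd rfl hxy
    | @cons _ w _ hyw q =>
      have hw : w ∉ S := fun hw => hyw.2 ⟨hyw.1, hy, hw⟩
      cases q with
      | nil => exact absurd hx hw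
      | @cons _ z _ hwz q =>
        cases q with
        | nil => exact ⟨w, hw, x, hx, y, hy, hxy, hwz.1, hyw.1.symm⟩
        | cons _ _ =>
          simp only [Walk.length_cons] at hq
          omega

lemma finite (h : TwoConnected G) : Finite V :=
  Nat.finite_of_card_ne_zero (by have := h.2.1; omega)

/-- A 2-connected chordal graph has a connected set of every size `k + 2` spanning at least
`2 * (k + 2) - 3` edges. -/
lemma exists_connected_set (h : TwoConnected G) (hch : Chordal G) (k : ℕ)
    (hk : k + 2 ≤ Nat.card V) :
    ∃ S : Set V, S.ncard = k + 2 ∧ (∀ x ∈ S, ∀ y ∈ S, (G.within S).Reachable x y) ∧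
      2 * k + 1 ≤ (G.within S).edgeSet.ncard := by
  have := h.finite
  induction k with
  | zero =>
    have : Nontrivial V := Finite.one_lt_card_iff_nontrivial.1 (by omega)
    obtain ⟨a⟩ := h.1.nonempty
    obtain ⟨b, hab⟩ := h.1.preconnected.exists_adj_of_nontrivial a
    have hadj : (G.within {a, b}).Adj a b := ⟨hab, by simp, by simp⟩
    refine ⟨{a, b}, by simp [Set.ncard_pair hab.ne], ?_, ?_⟩
    · rintro x (rfl | rfl) y (rfl | rfl)
      exacts [.rfl, hadj.reachable, hadj.symm.reachable, .rfl]
    · exact (Set.ncard_pos (Set.toFinite _)).2 ⟨s(a, b), hadj⟩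
  | succ k ih =>
    obtain ⟨S, hcard, hconn, hedge⟩ := ih (by omega)
    have hnt : S.Nontrivial := (Set.one_lt_ncard_iff_nontrivial (s := S)).1 (by omega)
    have hne : S ≠ Set.univ := by
      rintro rfl
      rw [Set.ncard_univ] at hcard
      omega
    obtain ⟨w, hw, x, hx, y, hy, hxy, hwx, hwy⟩ := h.exists_notMem_adj_adj hch hnt hne hconn
    have hle : G.within S ≤ G.within (insert w S) :=
      fun u v huv => ⟨huv.1, .inr huv.2.1, .inr huv.2.2⟩
    have hwx' : (G.within (insert w S)).Adj w x := ⟨hwx, .inl rfl, .inr hx⟩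
    have hwy' : (G.within (insert w S)).Adj w y := ⟨hwy, .inl rfl, .inr hy⟩
    have hrx : ∀ z ∈ insert w S, (G.within (insert w S)).Reachable x z := by
      rintro z (rfl | hz)
      · exact hwx'.symm.reachable
      · exact (hconn x hx z hz).mono hle
    refine ⟨insert w S, ?_, fun a ha b hb => (hrx a ha).symm.trans (hrx b hb), ?_⟩
    · rw [Set.ncard_insert_of_notMem hw, hcard]
    · have hsub : insert s(w, x) (insert s(w, y) (G.within S).edgeSet) ⊆
          (G.within (insert w S)).edgeSet := by
        rintro e (rfl | rfl | he)
        exacts [hwx', hwy', edgeSet_mono hle he]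
      have := Set.ncard_le_ncard hsub (Set.toFinite _)
      rw [Set.ncard_insert_of_notMem, Set.ncard_insert_of_notMem] at this
      · omega
      · exact fun hc => hw (mem_edgeSet _ |>.1 hc).2.1
      · rintro (hc | hc)
        · simp only [Sym2.eq_iff, true_and] at hc
          rcases hc with hc | hc
          · exact hxy hc
          · exact hwx.ne hc.2.symm
        · exact hw (mem_edgeSet _ |>.1 hc).2.1

lemma two_mul_card_le (h : TwoConnected G) (hch : Chordal G) :
    2 * Nat.card V ≤ G.edgeSet.ncard + 3 := by
  have := h.finite
  have h3 := h.2.1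
  obtain ⟨S, -, -, hedge⟩ := h.exists_connected_set hch (Nat.card V - 2) (by omega)
  have := Set.ncard_le_ncard (edgeSet_mono (fun u v huv => huv.1 : G.within S ≤ G))
    (Set.toFinite _)
  omega

end TwoConnected

lemma IsMatchingIn.two_mul_ncard_le {V : Type*} [Finite V] {G : SimpleGraph V} {M : Set (Sym2 V)}
    (h : IsMatchingIn G M) : 2 * M.ncard ≤ Nat.card V := by
  classical
  have := Fintype.ofFinite V
  have hdisj : (M.toFinset : Set (Sym2 V)).PairwiseDisjoint Sym2.toFinset := by
    intro e he f hf hef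
    rw [Function.onFun, Finset.disjoint_left]
    intro v hv hv'
    exact h.2 e (by simpa using he) f (by simpa using hf) hef v (by simpa using hv)
      (by simpa using hv')
  have hcard := Finset.card_biUnion hdisj
  rw [Finset.sum_const_nat (m := 2) fun e he => Sym2.card_toFinset_of_not_isDiag e
    (G.not_isDiag_of_mem_edgeSet (h.1 (by simpa using he)))] at hcard
  rw [Set.ncard_eq_toFinset_card', mul_comm, ← hcard, Nat.card_eq_fintype_card]
  exact Finset.card_le_univ _

lemma SimpleGraph.IsAcyclic.ncard_edgeSet_lt {V : Type*} [Finite V] [Nonempty V]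
    {F : SimpleGraph V} (hF : F.IsAcyclic) : F.edgeSet.ncard < Nat.card V := by
  obtain ⟨T, hFT, -, hT⟩ := connected_top.exists_isTree_le_of_le_of_isAcyclic le_top hF
  have h1 := (isTree_iff_connected_and_card.1 hT).2
  have h2 := Set.ncard_le_ncard (edgeSet_mono hFT) (Set.toFinite _)
  rw [← Nat.card_coe_set_eq T.edgeSet] at h2
  omega

lemma MDecyclable.ncard_edgeSet_le {V : Type*} [Finite V] [Nonempty V] {G : SimpleGraph V}
    (h : MDecyclable G) : G.edgeSet.ncard ≤ 3 * Nat.card V / 2 - 1 := by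
  obtain ⟨M, hM, hF⟩ := h
  have h1 := hM.two_mul_ncard_le
  have h2 := hF.ncard_edgeSet_lt
  have h3 := Set.ncard_le_ncard_sdiff_add_ncard G.edgeSet M (Set.toFinite _)
  rw [edgeSet_deleteEdges] at h2
  omega

lemma MDecyclable.of_embedding {V W : Type*} {G : SimpleGraph V} {H : SimpleGraph W}
    (e : G ↪g H) (h : MDecyclable H) : MDecyclable G := by
  obtain ⟨M, hM, hF⟩ := h
  have hinj := Sym2.map.injective e.injective
  refine ⟨Sym2.map e ⁻¹' M, ⟨fun x hx => ?_, fun x hx y hy hxy v hv hv' => ?_⟩, ?_⟩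
  · induction x with
    | _ a b => exact e.map_adj_iff.1 (hM.1 hx)
  · exact hM.2 _ hx _ hy (hinj.ne hxy) (e v) (Sym2.mem_map.2 ⟨v, hv, rfl⟩)
      (Sym2.mem_map.2 ⟨v, hv', rfl⟩)
  · refine hF.comap ⟨e, fun {a b} hab => ?_⟩ e.injective
    rw [deleteEdges_adj] at hab ⊢
    exact ⟨e.map_adj_iff.2 hab.1, hab.2⟩

lemma diamondGraph_adj (a b : Fin 4) :
    diamondGraph.Adj a b ↔ a ≠ b ∧ s(a, b) ≠ s(1, 3) := by
  simp only [diamondGraph, fromEdgeSet_adj, Set.mem_insert_iff, Set.mem_singleton_iff]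
  revert a b
  decide

lemma isAcyclic_pathGraph_four : (pathGraph 4).IsAcyclic := by
  refine (isTree_iff_connected_and_card.2 ⟨pathGraph_connected 3, ?_⟩).isAcyclic
  have : (pathGraph 4).edgeSet = ({s(0, 1), s(1, 2), s(2, 3)} : Finset (Sym2 (Fin 4))) := by
    ext e
    induction e with
    | _ a b =>
      rw [mem_edgeSet, pathGraph_adj, Finset.mem_coe]
      revert a b
      decide
  rw [this, Nat.card_coe_set_eq, Set.ncard_coe_finset, Nat.card_eq_fintype_card]
  rfl

lemma mDecyclable_diamondGraph : MDecyclable diamondGraph := by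
  refine ⟨{s(0, 1), s(2, 3)}, ⟨?_, ?_⟩, ?_⟩
  · rintro e (rfl | rfl) <;> simp [diamondGraph_adj]
  · rintro e (rfl | rfl) f (rfl | rfl) h v hv hv' <;> revert h hv hv' v <;> decide
  · let f : diamondGraph.deleteEdges {s(0, 1), s(2, 3)} →g pathGraph 4 :=
      { toFun := ![2, 0, 1, 3]
        map_rel' := fun {a b} hab => by
          rw [deleteEdges_adj, diamondGraph_adj] at hab
          rw [pathGraph_adj]
          simp only [Set.mem_insert_iff, Set.mem_singleton_iff] at hab
          revert a b
          decide }
    have hf : Function.Injective (![2, 0, 1, 3] : Fin 4 → Fin 4) := by decide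
    exact isAcyclic_pathGraph_four.comap f hf

lemma mDecyclable_triangleGraph : MDecyclable triangleGraph := by
  refine mDecyclable_diamondGraph.of_embedding ⟨⟨![0, 1, 2], by decide⟩, fun {a b} => ?_⟩
  rw [diamondGraph_adj]
  change _ ↔ a ≠ b
  simp only [Function.Embedding.coeFn_mk]
  revert a b
  decide

lemma ncard_edgeSet_top {V : Type*} [Finite V] :
    (⊤ : SimpleGraph V).edgeSet.ncard = (Nat.card V).choose 2 := by
  classical
  have := Fintype.ofFinite V
  rw [← coe_edgeFinset, Set.ncard_coe_finset, card_edgeFinset_top_eq_card_choose_two,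
    Nat.card_eq_fintype_card]

lemma nonempty_iso_diamondGraph {V : Type*} {G : SimpleGraph V} (hV : Nat.card V = 4)
    (hG : G.edgeSet.ncard = 5) : Nonempty (G ≃g diamondGraph) := by
  have : Finite V := Nat.finite_of_card_ne_zero (by omega)
  have htop : (⊤ : SimpleGraph V).edgeSet.ncard = 6 := by
    rw [ncard_edgeSet_top, hV]
    rfl
  obtain ⟨u, v, huv, hnadj⟩ : ∃ u v, u ≠ v ∧ ¬ G.Adj u v := by
    by_contra! hall
    have : G = ⊤ := top_unique fun a b hab => hall a b hab
    rw [this] at hG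
    omega
  have hsub : G.edgeSet ⊆ (⊤ : SimpleGraph V).edgeSet \ {s(u, v)} := fun e he =>
    ⟨edgeSet_mono le_top he, fun h => hnadj (by rwa [Set.mem_singleton_iff.1 h] at he)⟩
  have heq := Set.eq_of_subset_of_ncard_le hsub (by
    rw [Set.ncard_sdiff_singleton_of_mem (show s(u, v) ∈ (⊤ : SimpleGraph V).edgeSet from huv)]
    omega)
  have hadj : ∀ a b, G.Adj a b ↔ a ≠ b ∧ s(a, b) ≠ s(u, v) := by
    intro a b
    rw [← mem_edgeSet, heq]
    rfl
  obtain ⟨e, heu, hev⟩ : ∃ e : V ≃ Fin 4, e u = 1 ∧ e v = 3 := by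
    let e := (Finite.equivFinOfCardEq hV).trans (.swap (Finite.equivFinOfCardEq hV u) 1)
    have heu : e u = 1 := Equiv.swap_apply_left _ _
    refine ⟨e.trans (.swap (e v) 3), ?_, Equiv.swap_apply_left _ _⟩
    rw [Equiv.trans_apply, heu]
    exact Equiv.swap_apply_of_ne_of_ne (heu ▸ e.injective.ne huv) (by decide)
  refine ⟨⟨e, fun {a b} => ?_⟩⟩
  rw [diamondGraph_adj, hadj, ← heu, ← hev, e.injective.ne_iff, ← Sym2.map_mk, ← Sym2.map_mk,
    (Sym2.map.injective e.injective).ne_iff]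

lemma nonempty_iso_triangleGraph {V : Type*} {G : SimpleGraph V} (hV : Nat.card V = 3)
    (hG : 3 ≤ G.edgeSet.ncard) : Nonempty (G ≃g triangleGraph) := by
  have : Finite V := Nat.finite_of_card_ne_zero (by omega)
  obtain rfl : G = ⊤ := edgeSet_injective <|
    Set.eq_of_subset_of_ncard_le (edgeSet_mono le_top) (by rwa [ncard_edgeSet_top, hV])
  exact ⟨Iso.completeGraph (Finite.equivFinOfCardEq hV)⟩

theorem stmt14 {V : Type*} (G : SimpleGraph V) (hch : Chordal G)
    (h2 : TwoConnected G) :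
    MDecyclable G ↔
      Nonempty (G ≃g diamondGraph) ∨ Nonempty (G ≃g triangleGraph) := by
  constructor
  · intro h
    have := h2.finite
    have := h2.1.nonempty
    have hlow := h2.two_mul_card_le hch
    have hup := h.ncard_edgeSet_le
    have h3 := h2.2.1
    obtain hV | hV : Nat.card V = 4 ∨ Nat.card V = 3 := by omega
    · exact .inl (nonempty_iso_diamondGraph hV (by omega))
    · exact .inr (nonempty_iso_triangleGraph hV (by omega))
  · rintro (⟨⟨e⟩⟩ | ⟨⟨e⟩⟩)
    · exact mDecyclable_diamondGraph.of_embedding e.toEmbedding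
    · exact mDecyclable_triangleGraph.of_embedding e.toEmbedding
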